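/- arXiv:1902.03226 — 11 statements merged into one kernel-verified Lean document; each statement's English description precedes it below -/
import Mathlib

section
/- Let J₀, J, β be real and let h = s·I₂ + t·σz with s, t real. Then the normalized partial trace onto the first tensor factor of A·(I₂⊗h⊗h)·A* equals (C₁s² + C₂t²)·I₂ + C₃·s·t·σz, where A* is the conjugate transpose of A. -/
open Matrix Kronecker

noncomputable section

def σx : Matrix (Fin 2) (Fin 2) ℂ := !![0, 1; 1, 0]
def σy : Matrix (Fin 2) (Fin 2) ℂ := !![0, -Complex.I; Complex.I, 0]
def σz : Matrix (Fin 2) (Fin 2) ℂ := !![1, 0; 0, -1]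

abbrev M8 := Matrix (Fin 2 × Fin 2 × Fin 2) (Fin 2 × Fin 2 × Fin 2) ℂ

def I2 : Matrix (Fin 2) (Fin 2) ℂ := 1

/-- The operator `A = γ₁ I⊗I⊗I + γ₂ I⊗σx⊗σx + γ₂ I⊗σy⊗σy + γ₃ I⊗σz⊗σz
  + δ₁ σz⊗I⊗σz + δ₁ σz⊗σz⊗I`. -/
def A (J₀ J β : ℝ) : M8 :=
  ((1/4) * (Real.exp (2 * J₀ * β) + 1 + 2 * Real.exp (J₀ * β) * Real.cosh (J * β))) • (I2 ⊗ₖ (I2 ⊗ₖ I2))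
  + ((1/2) * Real.exp (J₀ * β) * Real.sinh (J * β)) • (I2 ⊗ₖ (σx ⊗ₖ σx))
  + ((1/2) * Real.exp (J₀ * β) * Real.sinh (J * β)) • (I2 ⊗ₖ (σy ⊗ₖ σy))
  + ((1/4) * (Real.exp (2 * J₀ * β) + 1 - 2 * Real.exp (J₀ * β) * Real.cosh (J * β))) • (I2 ⊗ₖ (σz ⊗ₖ σz))
  + ((1/4) * (Real.exp (2 * J₀ * β) - 1)) • (σz ⊗ₖ (I2 ⊗ₖ σz))
  + ((1/4) * (Real.exp (2 * J₀ * β) - 1)) • (σz ⊗ₖ (σz ⊗ₖ I2))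

/-- Normalized partial trace onto the first tensor factor:
  `tr₂₃(M)(i,i′) = (1/4)·Σ_{j,k} M((i,j,k),(i′,j,k))`. -/
def ptr (M : M8) : Matrix (Fin 2) (Fin 2) ℂ :=
  Matrix.of fun i i' => (1/4 : ℂ) * ∑ j : Fin 2, ∑ k : Fin 2, M (i, j, k) (i', j, k)

def C₁ (J₀ J β : ℝ) : ℝ :=
  (1/4) * (Real.exp (4 * J₀ * β) + 1) + (1/2) * Real.exp (2 * J₀ * β) * Real.cosh (2 * J * β)

def C₂ (J₀ J β : ℝ) : ℝ :=
  (1/4) * (Real.exp (4 * J₀ * β) + 1) - (1/2) * Real.exp (2 * J₀ * β) * Real.cosh (2 * J * β)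

def C₃ (J₀ J β : ℝ) : ℝ := (1/2) * (Real.exp (4 * J₀ * β) - 1)

lemma exp_two_mul_mul (x y : ℝ) : Real.exp (2 * x * y) = Real.exp (x * y) ^ 2 := by
  rw [← Real.exp_nat_mul]; push_cast; ring_nf

lemma exp_four_mul_mul (x y : ℝ) : Real.exp (4 * x * y) = Real.exp (x * y) ^ 4 := by
  rw [← Real.exp_nat_mul]; push_cast; ring_nf

lemma cosh_two_mul_mul (x y : ℝ) :
    Real.cosh (2 * x * y) = Real.cosh (x * y) ^ 2 + Real.sinh (x * y) ^ 2 := by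
  rw [mul_assoc, Real.cosh_two_mul]

/-- The matrix `A` is block diagonal in the spin basis, with nonzero entries `exp (2J₀β)`, `1`,
`exp (J₀β) cosh (Jβ)` and `exp (J₀β) sinh (Jβ)`. -/
lemma A_apply (J₀ J β : ℝ) (i j k i' j' k' : Fin 2) :
    A J₀ J β (i, j, k) (i', j', k') =
      if i = i' then
        if j = k then
          if j' = j ∧ k' = j then (if i = j then ((Real.exp (J₀ * β) ^ 2 : ℝ) : ℂ) else 1) else 0
        else if j' = j ∧ k' = k then ((Real.exp (J₀ * β) * Real.cosh (J * β) : ℝ) : ℂ)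
        else if j' = k ∧ k' = j then ((Real.exp (J₀ * β) * Real.sinh (J * β) : ℝ) : ℂ)
        else 0
      else 0 := by
  unfold A
  rw [exp_two_mul_mul]
  generalize Real.exp (J₀ * β) = a
  generalize Real.cosh (J * β) = c
  generalize Real.sinh (J * β) = d
  fin_cases i <;> fin_cases i' <;> fin_cases j <;> fin_cases j' <;> fin_cases k <;>
    fin_cases k' <;> simp [I2, σx, σy, σz] <;> ring

theorem ptr_A_h_h (J₀ J β s t : ℝ) :
    let h : Matrix (Fin 2) (Fin 2) ℂ := s • I2 + t • σz
    ptr (A J₀ J β * (I2 ⊗ₖ (h ⊗ₖ h)) * (A J₀ J β)ᴴ)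
      = (C₁ J₀ J β * s ^ 2 + C₂ J₀ J β * t ^ 2) • I2 + (C₃ J₀ J β * s * t) • σz := by
  intro h
  ext i i'
  simp only [ptr, Matrix.of_apply, Matrix.mul_apply, Fintype.sum_prod_type, Fin.sum_univ_two,
    Matrix.conjTranspose_apply, A_apply, C₁, C₂, C₃, exp_two_mul_mul, exp_four_mul_mul,
    cosh_two_mul_mul]
  generalize Real.exp (J₀ * β) = a
  generalize Real.cosh (J * β) = c
  generalize Real.sinh (J * β) = d
  fin_cases i <;> fin_cases i' <;> simp [h, I2, σz] <;> ring
end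
end

section
/- Let J₀, J, β be real, so that C₁ > 0, and set α = 1/C₁ and h_α = α·I₂. Then the normalized partial trace onto the first tensor factor of A·(I₂⊗h_α⊗h_α)·A* equals h_α; that is, h_α is a fixed point of the renormalization map (the translation-invariant boundary condition describing the disordered phase). -/
open Matrix Kronecker

noncomputable section

theorem C₁_pos (J₀ J β : ℝ) : 0 < C₁ J₀ J β := by
  unfold C₁
  positivity

/-- Distinct Pauli strings on the last two factors are orthogonal for the trace, so only
the squares of the coefficients survive the partial trace. -/
theorem ptr_pauli_mul_conjTranspose (a b c d : ℝ) (M : M8)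
    (hM : M = a • (I2 ⊗ₖ (I2 ⊗ₖ I2)) + b • (I2 ⊗ₖ (σx ⊗ₖ σx)) + b • (I2 ⊗ₖ (σy ⊗ₖ σy))
      + c • (I2 ⊗ₖ (σz ⊗ₖ σz)) + d • (σz ⊗ₖ (I2 ⊗ₖ σz)) + d • (σz ⊗ₖ (σz ⊗ₖ I2))) :
    ptr (M * Mᴴ) = (a ^ 2 + 2 * b ^ 2 + c ^ 2 + 2 * d ^ 2) • I2 := by
  subst hM
  ext i j
  fin_cases i <;> fin_cases j <;>
    simp [ptr, I2, σx, σy, σz, Matrix.mul_apply, Fintype.sum_prod_type, Matrix.one_apply] <;>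
    ring

theorem ptr_A_mul_conjTranspose (J₀ J β : ℝ) :
    ptr (A J₀ J β * (A J₀ J β)ᴴ) = C₁ J₀ J β • I2 := by
  rw [ptr_pauli_mul_conjTranspose _ _ _ _ (A J₀ J β) rfl]
  congr 1
  have h2 : Real.exp (2 * J₀ * β) = Real.exp (J₀ * β) ^ 2 := by
    rw [← Real.exp_nat_mul]; congr 1; push_cast; ring
  have h4 : Real.exp (4 * J₀ * β) = Real.exp (J₀ * β) ^ 4 := by
    rw [← Real.exp_nat_mul]; congr 1; push_cast; ring
  have hc : Real.cosh (2 * J * β) = Real.cosh (J * β) ^ 2 + Real.sinh (J * β) ^ 2 := by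
    rw [mul_assoc, Real.cosh_two_mul]
  rw [C₁, h2, h4, hc]
  ring

theorem ptr_smul (r : ℝ) (M : M8) : ptr (r • M) = r • ptr M := by
  ext i j
  simp only [ptr, Matrix.of_apply, Matrix.smul_apply, ← Finset.smul_sum, mul_smul_comm]

/-- `C₁ > 0`, and the disordered boundary condition `h_α = (1/C₁)·I₂` is a fixed
point of the renormalization map. -/
theorem disordered_fixed_point (J₀ J β : ℝ) :
    0 < C₁ J₀ J β ∧
    (let α : ℝ := 1 / C₁ J₀ J β
     let hα : Matrix (Fin 2) (Fin 2) ℂ := α • I2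
     ptr (A J₀ J β * (I2 ⊗ₖ (hα ⊗ₖ hα)) * (A J₀ J β)ᴴ) = hα) := by
  refine ⟨C₁_pos J₀ J β, ?_⟩
  intro α hα
  have h : I2 ⊗ₖ (hα ⊗ₖ hα) = (α * α) • (1 : M8) := by
    simp only [hα, I2, Matrix.smul_kronecker, Matrix.kronecker_smul, Matrix.one_kronecker_one,
      smul_smul]
  have hC : α * C₁ J₀ J β = 1 := one_div_mul_cancel (C₁_pos J₀ J β).ne'
  rw [h, mul_smul_comm, mul_one, smul_mul_assoc, ptr_smul, ptr_A_mul_conjTranspose, smul_smul,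
    mul_assoc, hC, mul_one]
end
end

section
/- Let J₀ > 0, β > 0 and J ∈ ℝ with J ≠ J₀ and J ≠ −J₀ (so that C₂ ≠ 0). Then Δ = (C₃−C₁)/C₂ satisfies Δ > 0 if and only if either |J| > J₀, or (|J| < J₀ and J₀ > (1/(2β))·ln( cosh(2Jβ) + √(cosh²(2Jβ) + 3) )). -/
noncomputable section

def Δ (J₀ J β : ℝ) : ℝ := (C₃ J₀ J β - C₁ J₀ J β) / C₂ J₀ J β

lemma C₂_eq_exp_mul_cosh_sub_cosh (J₀ J β : ℝ) :
    C₂ J₀ J β = Real.exp (2 * J₀ * β) * (Real.cosh (2 * J₀ * β) - Real.cosh (2 * J * β)) / 2 := by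
  have hsq : Real.exp (4 * J₀ * β) = Real.exp (2 * J₀ * β) * Real.exp (2 * J₀ * β) := by
    rw [← Real.exp_add]; ring_nf
  have hinv : Real.exp (2 * J₀ * β) * Real.exp (-(2 * J₀ * β)) = 1 := by
    rw [← Real.exp_add]; simp
  rw [C₂, hsq, Real.cosh_eq (2 * J₀ * β)]
  linear_combination -(1 / 4) * hinv

lemma C₃_sub_C₁ (J₀ J β : ℝ) : C₃ J₀ J β - C₁ J₀ J β = C₂ J₀ J β - 1 := by
  rw [C₁, C₂, C₃]; ring

lemma cosh_two_mul_lt_cosh_two_mul_iff {β : ℝ} (hβ : 0 < β) (a b : ℝ) :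
    Real.cosh (2 * a * β) < Real.cosh (2 * b * β) ↔ |a| < |b| := by
  rw [Real.cosh_lt_cosh, abs_mul, abs_mul, abs_mul, abs_mul, abs_of_pos hβ,
    mul_lt_mul_iff_left₀ hβ, mul_lt_mul_iff_right₀ (by norm_num)]

lemma add_sqrt_sq_add_three_lt_iff {c x : ℝ} (hx : 0 < x) :
    c + Real.sqrt (c ^ 2 + 3) < x ↔ 0 < x ^ 2 - 2 * x * c - 3 := by
  have hs := Real.sq_sqrt (show 0 ≤ c ^ 2 + 3 by positivity)
  have hc : c < Real.sqrt (c ^ 2 + 3) := Real.lt_sqrt_of_sq_lt (by linarith)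
  have hfactor : x ^ 2 - 2 * x * c - 3 =
      (x - c + Real.sqrt (c ^ 2 + 3)) * (x - (c + Real.sqrt (c ^ 2 + 3))) := by
    linear_combination hs
  rw [hfactor, mul_pos_iff_of_pos_left (by linarith), sub_pos]

theorem Delta_pos_iff (J₀ J β : ℝ) (hJ₀ : 0 < J₀) (hβ : 0 < β)
    (h₁ : J ≠ J₀) (h₂ : J ≠ -J₀) :
    0 < Δ J₀ J β ↔
      (J₀ < |J| ∨ (|J| < J₀ ∧
        (1 / (2 * β)) * Real.log (Real.cosh (2 * J * β)
          + Real.sqrt (Real.cosh (2 * J * β) ^ 2 + 3)) < J₀)) := by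
  have habs : |J| ≠ J₀ := fun h ↦ by
    rcases (abs_eq hJ₀.le).1 h with h | h
    exacts [h₁ h, h₂ h]
  have hexp := Real.exp_pos (2 * J₀ * β)
  rw [Δ, C₃_sub_C₁]
  rcases habs.lt_or_gt with h | h
  · have hcosh := (cosh_two_mul_lt_cosh_two_mul_iff hβ J J₀).2 (by rwa [abs_of_pos hJ₀])
    have hC₂ : 0 < C₂ J₀ J β := by
      rw [C₂_eq_exp_mul_cosh_sub_cosh]
      exact half_pos (mul_pos hexp (sub_pos.2 hcosh))
    have hlog : (1 / (2 * β)) * Real.log (Real.cosh (2 * J * β)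
        + Real.sqrt (Real.cosh (2 * J * β) ^ 2 + 3)) < J₀ ↔
        0 < C₂ J₀ J β - 1 := by
      have hpos : 0 < Real.cosh (2 * J * β) + Real.sqrt (Real.cosh (2 * J * β) ^ 2 + 3) :=
        add_pos_of_pos_of_nonneg (Real.cosh_pos _) (Real.sqrt_nonneg _)
      have hsq : Real.exp (4 * J₀ * β) = Real.exp (2 * J₀ * β) ^ 2 := by
        rw [← Real.exp_nat_mul]; ring_nf
      rw [one_div_mul_eq_div, div_lt_iff₀ (by positivity),
        show J₀ * (2 * β) = 2 * J₀ * β by ring, Real.log_lt_iff_lt_exp hpos,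
        add_sqrt_sq_add_three_lt_iff hexp, C₂, hsq]
      constructor <;> intro <;> linarith
    rw [hlog, div_pos_iff_of_pos_right hC₂]
    simp [h, h.not_gt]
  · have hcosh := (cosh_two_mul_lt_cosh_two_mul_iff hβ J₀ J).2 (by rwa [abs_of_pos hJ₀])
    have hC₂ : C₂ J₀ J β < 0 := by
      rw [C₂_eq_exp_mul_cosh_sub_cosh]
      exact div_neg_of_neg_of_pos (mul_neg_of_pos_of_neg hexp (sub_neg.2 hcosh)) two_pos
    exact iff_of_true (div_pos_of_neg_of_neg (by linarith) hC₂) (Or.inl h)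
end
end

section
/- Let J₀ > 0, β > 0 and J ∈ ℝ with C₂ ≠ 0 and Δ = (C₃−C₁)/C₂ > 0, and set ξ₀ = 1/C₃, ξ₃ = √Δ/C₃ (note C₃ > 0). Then the set of real pairs (s,t) with t ≠ 0 satisfying the system s = C₁s² + C₂t² and t = C₃·s·t is exactly { (ξ₀, ξ₃), (ξ₀, −ξ₃) }. -/
noncomputable section

lemma C₃_pos {J₀ J β : ℝ} (hJ₀ : 0 < J₀) (hβ : 0 < β) : 0 < C₃ J₀ J β := by
  have h : 1 < Real.exp (4 * J₀ * β) := Real.one_lt_exp_iff.mpr (by positivity)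
  unfold C₃
  linarith

/-- Over the reals, the solutions with `t ≠ 0` of `s = a s² + b t²`, `t = c s t` are
`s = 1 / c`, `t = ± √((c - a) / b) / c`. -/
lemma solutions_snd_ne_zero {a b c : ℝ} (hb : b ≠ 0) (hc : c ≠ 0) (hd : 0 < (c - a) / b) :
    {p : ℝ × ℝ | p.2 ≠ 0 ∧ p.1 = a * p.1 ^ 2 + b * p.2 ^ 2 ∧ p.2 = c * p.1 * p.2}
      = {(1 / c, √((c - a) / b) / c), (1 / c, -(√((c - a) / b) / c))} := by
  have hr : √((c - a) / b) ≠ 0 := (Real.sqrt_pos.mpr hd).ne'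
  have hsq : b * √((c - a) / b) ^ 2 = c - a := by
    rw [Real.sq_sqrt hd.le]
    field_simp
  generalize √((c - a) / b) = r at hr hsq
  have hsol : 1 / c = a * (1 / c) ^ 2 + b * (r / c) ^ 2 := by
    field_simp
    linarith
  have ht : ∀ t : ℝ, t = c * (1 / c) * t := fun t => by field_simp
  ext ⟨s, t⟩
  simp only [Set.mem_ofPred_eq, Set.mem_insert_iff, Set.mem_singleton_iff, Prod.mk.injEq]
  constructor
  · rintro ⟨h0, h1, h2⟩
    have hs : s = 1 / c := by
      rw [eq_div_iff hc]
      apply mul_right_cancel₀ h0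
      linarith
    subst hs
    have hsq' : t ^ 2 = (r / c) ^ 2 := mul_left_cancel₀ hb (by linarith)
    exact (sq_eq_sq_iff_eq_or_eq_neg.mp hsq').imp (⟨rfl, ·⟩) (⟨rfl, ·⟩)
  · rintro (⟨rfl, rfl⟩ | ⟨rfl, rfl⟩)
    · exact ⟨div_ne_zero hr hc, hsol, ht _⟩
    · exact ⟨neg_ne_zero.mpr (div_ne_zero hr hc), by rwa [neg_sq], ht _⟩

theorem nontrivial_solutions (J₀ J β : ℝ) (hJ₀ : 0 < J₀) (hβ : 0 < β)
    (hC₂ : C₂ J₀ J β ≠ 0) (hΔ : 0 < Δ J₀ J β) :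
    let ξ₀ : ℝ := 1 / C₃ J₀ J β
    let ξ₃ : ℝ := Real.sqrt (Δ J₀ J β) / C₃ J₀ J β
    {p : ℝ × ℝ | p.2 ≠ 0 ∧
        p.1 = C₁ J₀ J β * p.1 ^ 2 + C₂ J₀ J β * p.2 ^ 2 ∧
        p.2 = C₃ J₀ J β * p.1 * p.2}
      = {(ξ₀, ξ₃), (ξ₀, -ξ₃)} := by
  exact solutions_snd_ne_zero hC₂ (C₃_pos hJ₀ hβ).ne' hΔ
end
end

section
/- Let J₀ > 0, β > 0 and J ∈ ℝ with C₂ ≠ 0 and Δ = (C₃−C₁)/C₂ > 0, and set ξ₀ = 1/C₃, ξ₃ = √Δ/C₃. Then both 2×2 matrices h = ξ₀·I₂ + ξ₃·σz and h′ = ξ₀·I₂ − ξ₃·σz satisfy the fixed-point equation: the normalized partial trace onto the first tensor factor of A·(I₂⊗h⊗h)·A* equals h, and likewise with h′ in place of h. -/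
open Matrix Kronecker

noncomputable section

/-- The channel `M ↦ tr₂₃(A M A*)` applied to `1 ⊗ h ⊗ h` with `h = p + q σz`, for an operator `A`
of the given shape with arbitrary real coefficients. -/
lemma ptr_conj_kronecker (c₁ c₂ c₃ d p q : ℝ) :
    let B : M8 := c₁ • (I2 ⊗ₖ (I2 ⊗ₖ I2)) + c₂ • (I2 ⊗ₖ (σx ⊗ₖ σx)) + c₂ • (I2 ⊗ₖ (σy ⊗ₖ σy))
      + c₃ • (I2 ⊗ₖ (σz ⊗ₖ σz)) + d • (σz ⊗ₖ (I2 ⊗ₖ σz)) + d • (σz ⊗ₖ (σz ⊗ₖ I2))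
    let h : Matrix (Fin 2) (Fin 2) ℂ := p • I2 + q • σz
    ptr (B * (I2 ⊗ₖ (h ⊗ₖ h)) * Bᴴ) =
      ((c₁ ^ 2 + 2 * c₂ ^ 2 + c₃ ^ 2 + 2 * d ^ 2) * p ^ 2
        + (2 * c₁ * c₃ - 2 * c₂ ^ 2 + 2 * d ^ 2) * q ^ 2) • I2
      + (4 * d * (c₁ + c₃) * p * q) • σz := by
  intro B h
  ext i j
  fin_cases i <;> fin_cases j <;>
    simp [B, h, ptr, Matrix.mul_apply, Fintype.sum_prod_type, Fin.sum_univ_two, I2, σx, σy, σz,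
      Matrix.one_apply] <;>
    ring

/-- `p + q σz` is a fixed point as soon as `(p, q)` solves the reduced scalar system. -/
lemma ptr_A_eq_self {J₀ J β p q : ℝ}
    (hp : C₁ J₀ J β * p ^ 2 + C₂ J₀ J β * q ^ 2 = p) (hq : C₃ J₀ J β * p * q = q) :
    ptr (A J₀ J β * (I2 ⊗ₖ ((p • I2 + q • σz) ⊗ₖ (p • I2 + q • σz))) * (A J₀ J β)ᴴ)
      = p • I2 + q • σz := by
  have e₂ : Real.exp (2 * J₀ * β) = Real.exp (J₀ * β) ^ 2 := by
    rw [← Real.exp_nat_mul]; congr 1; push_cast; ring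
  have e₄ : Real.exp (4 * J₀ * β) = Real.exp (J₀ * β) ^ 4 := by
    rw [← Real.exp_nat_mul]; congr 1; push_cast; ring
  have hc : Real.cosh (2 * J * β) = Real.cosh (J * β) ^ 2 + Real.sinh (J * β) ^ 2 := by
    rw [mul_assoc, Real.cosh_two_mul]
  have hs := Real.cosh_sq (J * β)
  unfold A
  rw [ptr_conj_kronecker]
  simp only [C₁, C₂, C₃, e₂, e₄, hc] at hp hq ⊢
  congr 2
  · linear_combination hp
  · linear_combination hq

theorem ordered_fixed_points (J₀ J β : ℝ) (hJ₀ : 0 < J₀) (hβ : 0 < β)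
    (hC₂ : C₂ J₀ J β ≠ 0)
    (hΔ : 0 < (C₃ J₀ J β - C₁ J₀ J β) / C₂ J₀ J β) :
    let ξ₀ : ℝ := 1 / C₃ J₀ J β
    let ξ₃ : ℝ := Real.sqrt ((C₃ J₀ J β - C₁ J₀ J β) / C₂ J₀ J β) / C₃ J₀ J β
    let h : Matrix (Fin 2) (Fin 2) ℂ := ξ₀ • I2 + ξ₃ • σz
    let h' : Matrix (Fin 2) (Fin 2) ℂ := ξ₀ • I2 - ξ₃ • σz
    ptr (A J₀ J β * (I2 ⊗ₖ (h ⊗ₖ h)) * (A J₀ J β)ᴴ) = h ∧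
    ptr (A J₀ J β * (I2 ⊗ₖ (h' ⊗ₖ h')) * (A J₀ J β)ᴴ) = h' := by
  intro ξ₀ ξ₃ h h'
  have hC₃ : 0 < C₃ J₀ J β := by
    have : 1 < Real.exp (4 * J₀ * β) := Real.one_lt_exp_iff.mpr (by positivity)
    unfold C₃
    linarith
  have hp : C₁ J₀ J β * ξ₀ ^ 2 + C₂ J₀ J β * ξ₃ ^ 2 = ξ₀ := by
    simp only [ξ₀, ξ₃, div_pow, Real.sq_sqrt hΔ.le]
    field_simp
    ring
  have hq : C₃ J₀ J β * ξ₀ * ξ₃ = ξ₃ := by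
    simp only [ξ₀, mul_one_div_cancel hC₃.ne', one_mul]
  have h_neg : h' = ξ₀ • I2 + (-ξ₃) • σz := by
    simp only [h', neg_smul, sub_eq_add_neg]
  refine ⟨ptr_A_eq_self hp hq, ?_⟩
  rw [h_neg]
  exact ptr_A_eq_self (by rwa [neg_sq]) (by rw [mul_neg, hq])
end
end

section
/- Let J₀ > 0, β > 0 and J ∈ ℝ with C₂ ≠ 0, and suppose Δ = (C₃−C₁)/C₂ ≤ 0. Then every real pair (s,t) with s ≠ 0 satisfying the system s = C₁s² + C₂t² and t = C₃·s·t has t = 0 and s = 1/C₁. In particular, for Δ ≤ 0 the translation-invariant boundary condition is unique and equals h = (1/C₁)·I₂. -/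
noncomputable section

theorem unique_solution_of_Delta_nonpos (J₀ J β : ℝ) (hJ₀ : 0 < J₀) (hβ : 0 < β)
    (hC₂ : C₂ J₀ J β ≠ 0) (hΔ : Δ J₀ J β ≤ 0) :
    ∀ s t : ℝ, s ≠ 0 →
      s = C₁ J₀ J β * s ^ 2 + C₂ J₀ J β * t ^ 2 →
      t = C₃ J₀ J β * s * t →
      t = 0 ∧ s = 1 / C₁ J₀ J β := by
  intro s t hs h₁ h₂
  have ht : t = 0 := by
    by_contra ht
    have h₃ : C₃ J₀ J β * s = 1 := mul_right_cancel₀ ht (by linarith)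
    have hC₃ : C₃ J₀ J β ≠ 0 := left_ne_zero_of_mul_eq_one h₃
    have hΔ_eq : Δ J₀ J β = (C₃ J₀ J β * t) ^ 2 := by
      rw [Δ, div_eq_iff hC₂]
      linear_combination C₃ J₀ J β ^ 2 * h₁ +
        (C₁ J₀ J β * (C₃ J₀ J β * s + 1) - C₃ J₀ J β) * h₃
    have hpos : 0 < (C₃ J₀ J β * t) ^ 2 := by positivity
    linarith
  refine ⟨ht, ?_⟩
  have h : s * C₁ J₀ J β = 1 := by
    apply mul_right_cancel₀ hs
    rw [ht] at h₁
    linear_combination -h₁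
  exact eq_one_div_of_mul_eq_one_left h
end
end

section
/- Let J₀, J, β be real and let e₁₁ = [[1,0],[0,0]] and e₂₂ = [[0,0],[0,1]] in M₂(ℂ). Then the normalized partial trace onto the first tensor factor of A·(e₁₁⊗e₁₁⊗e₁₁)·A* equals ((C₁+C₂+C₃)/4)·e₁₁, and the normalized partial trace onto the first tensor factor of A·(e₂₂⊗e₂₂⊗e₂₂)·A* equals ((C₁+C₂+C₃)/4)·e₂₂; moreover C₁+C₂+C₃ = exp(4J₀β). -/
open Matrix Kronecker

noncomputable section

def e₁₁ : Matrix (Fin 2) (Fin 2) ℂ := !![1, 0; 0, 0]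
def e₂₂ : Matrix (Fin 2) (Fin 2) ℂ := !![0, 0; 0, 1]

/-- If `p` is a projection with `σy p = ± i σx p` and `σz p = ± p`, then `p ⊗ p ⊗ p` consists of
eigenvectors of `A` with eigenvalue `exp(2J₀β)`. -/
theorem A_mul_kronecker (J₀ J β : ℝ) {p : Matrix (Fin 2) (Fin 2) ℂ} {s : ℂ} (hs : s * s = 1)
    (hy : σy * p = (s * Complex.I) • (σx * p)) (hz : σz * p = s • p) :
    A J₀ J β * (p ⊗ₖ (p ⊗ₖ p)) = Real.exp (2 * J₀ * β) • (p ⊗ₖ (p ⊗ₖ p)) := by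
  have hsI : s * Complex.I * (s * Complex.I) = -1 := by
    linear_combination (Complex.I * Complex.I) * hs + Complex.I_mul_I
  simp only [A, add_mul, smul_mul_assoc, ← mul_kronecker_mul, hy, hz, I2, one_mul,
    smul_kronecker, kronecker_smul, smul_smul, hs, hsI, one_smul]
  module

theorem ptr_conj_kronecker_s10 (J₀ J β : ℝ) {p : Matrix (Fin 2) (Fin 2) ℂ} {s : ℂ} (hs : s * s = 1)
    (hy : σy * p = (s * Complex.I) • (σx * p)) (hz : σz * p = s • p)
    (hp : p * p = p) (hH : pᴴ = p) (htr : p.trace = 1) :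
    ptr (A J₀ J β * (p ⊗ₖ (p ⊗ₖ p)) * (A J₀ J β)ᴴ) = (Real.exp (4 * J₀ * β) / 4) • p := by
  have hP : A J₀ J β * (p ⊗ₖ (p ⊗ₖ p)) * (A J₀ J β)ᴴ
      = Real.exp (4 * J₀ * β) • (p ⊗ₖ (p ⊗ₖ p)) := by
    calc A J₀ J β * (p ⊗ₖ (p ⊗ₖ p)) * (A J₀ J β)ᴴ
        = A J₀ J β * (p ⊗ₖ (p ⊗ₖ p)) * (A J₀ J β * (p ⊗ₖ (p ⊗ₖ p)))ᴴ := by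
          simp only [conjTranspose_mul, conjTranspose_kronecker, hH, ← Matrix.mul_assoc]
          rw [Matrix.mul_assoc (A J₀ J β) (p ⊗ₖ (p ⊗ₖ p)) (p ⊗ₖ (p ⊗ₖ p))]
          simp only [← mul_kronecker_mul, hp]
      _ = Real.exp (4 * J₀ * β) • (p ⊗ₖ (p ⊗ₖ p)) := by
          rw [A_mul_kronecker J₀ J β hs hy hz, conjTranspose_smul, star_trivial,
            conjTranspose_kronecker, conjTranspose_kronecker, hH, smul_mul_smul_comm,
            ← mul_kronecker_mul, ← mul_kronecker_mul, hp, ← Real.exp_add]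
          ring_nf
  rw [hP]
  rw [trace_fin_two] at htr
  ext i j
  simp only [ptr, of_apply, Matrix.smul_apply, kroneckerMap_apply, Fin.sum_univ_two, Complex.real_smul]
  push_cast
  linear_combination (1 / 4 * Complex.exp (4 * J₀ * β) * p i j * (p 0 0 + p 1 1 + 1)) * htr

theorem C_sum (J₀ J β : ℝ) : C₁ J₀ J β + C₂ J₀ J β + C₃ J₀ J β = Real.exp (4 * J₀ * β) := by
  simp only [C₁, C₂, C₃]
  ring

theorem ptr_A_projections (J₀ J β : ℝ) :
    ptr (A J₀ J β * (e₁₁ ⊗ₖ (e₁₁ ⊗ₖ e₁₁)) * (A J₀ J β)ᴴ)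
      = (((C₁ J₀ J β + C₂ J₀ J β + C₃ J₀ J β) / 4 : ℝ)) • e₁₁ ∧
    ptr (A J₀ J β * (e₂₂ ⊗ₖ (e₂₂ ⊗ₖ e₂₂)) * (A J₀ J β)ᴴ)
      = (((C₁ J₀ J β + C₂ J₀ J β + C₃ J₀ J β) / 4 : ℝ)) • e₂₂ ∧
    C₁ J₀ J β + C₂ J₀ J β + C₃ J₀ J β = Real.exp (4 * J₀ * β) := by
  rw [C_sum]
  refine ⟨ptr_conj_kronecker_s10 J₀ J β (s := 1) ?_ ?_ ?_ ?_ ?_ ?_,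
    ptr_conj_kronecker_s10 J₀ J β (s := -1) ?_ ?_ ?_ ?_ ?_ ?_, rfl⟩
  all_goals first
    | (norm_num; done)
    | (simp [e₁₁, trace_fin_two]; done)
    | (simp [e₂₂, trace_fin_two]; done)
    | (ext i j; fin_cases i <;> fin_cases j <;> simp [e₁₁, e₂₂, σx, σy, σz])
end
end

section
/- Fix a natural number n ≥ 1, J₀ > 0 and J ∈ ℝ with J ≠ J₀ and J ≠ −J₀. Regard C₁, C₂, C₃, Δ, ξ₀ = 1/C₃ as functions of β > 0. Then there exists β₀ > 0 such that Δ(β) > 0 for all β > β₀, and with ξ₃ = √Δ/C₃ the quantity G(β) = (1/(2ξ₀))·(ξ₀−ξ₃)^{2^n}·((C₁+C₂+C₃)/4)^{2^n−1} tends to 0 as β → +∞. (G(β) is the value φ₁(Qₙ) = φ₂(Pₙ); together with the limit of F(β) this shows the supports of the two states φ₁ and φ₂ do not overlap.) -/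
noncomputable section

def ξ₀ (J₀ J β : ℝ) : ℝ := 1 / C₃ J₀ J β

def ξ₃ (J₀ J β : ℝ) : ℝ := Real.sqrt (Δ J₀ J β) / C₃ J₀ J β

open Filter Topology

lemma tendsto_exp_mul_sub_exp_mul_atTop {p q : ℝ} (hp : 0 < p) (hqp : q < p) :
    Tendsto (fun x : ℝ => Real.exp (p * x) - Real.exp (q * x)) atTop atTop := by
  have hexp : Tendsto (fun x : ℝ => Real.exp (p * x)) atTop atTop :=
    Real.tendsto_exp_atTop.comp (tendsto_id.const_mul_atTop hp)
  have hratio : Tendsto (fun x : ℝ => 1 - Real.exp ((q - p) * x)) atTop (𝓝 1) := by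
    have h := Real.tendsto_exp_atBot.comp
      (tendsto_id.const_mul_atTop_of_neg (sub_neg.mpr hqp))
    simpa using h.const_sub 1
  refine (hexp.atTop_mul_pos one_pos hratio).congr fun x => ?_
  rw [mul_sub, mul_one, ← Real.exp_add]
  ring_nf

lemma C₂_eq_mul (J₀ J β : ℝ) :
    C₂ J₀ J β = 1 / 4 * ((Real.exp (2 * J₀ * β) - Real.exp (2 * |J| * β)) *
      (Real.exp (2 * J₀ * β) - Real.exp (-(2 * |J|) * β))) := by
  have hcosh : Real.cosh (2 * J * β) = Real.cosh (2 * |J| * β) := by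
    rcases abs_choice J with h | h <;> rw [h]
    rw [← Real.cosh_neg]
    ring_nf
  have hsq : Real.exp (4 * J₀ * β) = Real.exp (2 * J₀ * β) * Real.exp (2 * J₀ * β) := by
    rw [← Real.exp_add]
    ring_nf
  have hinv : Real.exp (2 * |J| * β) * Real.exp (-(2 * |J| * β)) = 1 := by
    rw [← Real.exp_add, add_neg_cancel, Real.exp_zero]
  rw [C₂, hcosh, Real.cosh_eq, hsq, neg_mul]
  linear_combination (-1 / 4) * hinv

lemma tendsto_C₂_cobounded {J₀ J : ℝ} (hJ₀ : 0 < J₀) (hJ : |J| ≠ J₀) :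
    Tendsto (C₂ J₀ J) atTop (Bornology.cobounded ℝ) := by
  have hsnd : Tendsto (fun β : ℝ => Real.exp (2 * J₀ * β) - Real.exp (-(2 * |J|) * β))
      atTop atTop :=
    tendsto_exp_mul_sub_exp_mul_atTop (by positivity) (by linarith [abs_nonneg J])
  rw [funext (C₂_eq_mul J₀ J)]
  rcases lt_or_gt_of_ne hJ with h | h
  · have hfst : Tendsto (fun β : ℝ => Real.exp (2 * J₀ * β) - Real.exp (2 * |J| * β))
        atTop atTop :=
      tendsto_exp_mul_sub_exp_mul_atTop (by positivity) (by linarith)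
    exact ((hfst.atTop_mul_atTop₀ hsnd).const_mul_atTop (by norm_num)).mono_right
      IsOrderBornology.atTop_le_cobounded
  · have hfst : Tendsto (fun β : ℝ => Real.exp (2 * J₀ * β) - Real.exp (2 * |J| * β))
        atTop atBot := by
      have hneg := tendsto_neg_atTop_atBot.comp
        (tendsto_exp_mul_sub_exp_mul_atTop (p := 2 * |J|) (q := 2 * J₀)
          (by linarith) (by linarith))
      exact hneg.congr fun β => neg_sub _ _
    exact ((hfst.atBot_mul_atTop₀ hsnd).const_mul_atBot (by norm_num)).mono_right
      IsOrderBornology.atBot_le_cobounded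

lemma Δ_eq_one_sub_inv {J₀ J β : ℝ} (h : C₂ J₀ J β ≠ 0) : Δ J₀ J β = 1 - (C₂ J₀ J β)⁻¹ := by
  have hsub : C₃ J₀ J β - C₁ J₀ J β = C₂ J₀ J β - 1 := by
    unfold C₁ C₂ C₃
    ring
  rw [Δ, hsub, sub_div, div_self h, one_div]

lemma tendsto_Δ {J₀ J : ℝ} (hJ₀ : 0 < J₀) (hJ : |J| ≠ J₀) :
    Tendsto (Δ J₀ J) atTop (𝓝 1) := by
  have hC₂ := tendsto_C₂_cobounded hJ₀ hJ
  have hlim : Tendsto (fun β => 1 - (C₂ J₀ J β)⁻¹) atTop (𝓝 1) := by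
    simpa using (tendsto_inv₀_cobounded.comp hC₂).const_sub 1
  refine hlim.congr' ?_
  filter_upwards [hC₂.eventually (Bornology.eventually_ne_cobounded 0)] with β hβ
  exact (Δ_eq_one_sub_inv hβ).symm

lemma C₁_add_C₂_add_C₃ (J₀ J β : ℝ) :
    C₁ J₀ J β + C₂ J₀ J β + C₃ J₀ J β = 2 * C₃ J₀ J β + 1 := by
  unfold C₁ C₂ C₃
  ring

lemma tendsto_C₃_atTop {J₀ : ℝ} (hJ₀ : 0 < J₀) (J : ℝ) : Tendsto (C₃ J₀ J) atTop atTop := by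
  have hexp : Tendsto (fun β : ℝ => Real.exp (4 * J₀ * β)) atTop atTop :=
    Real.tendsto_exp_atTop.comp (tendsto_id.const_mul_atTop (by positivity))
  exact (tendsto_atTop_add_const_right _ (-1) hexp).const_mul_atTop (by norm_num)

theorem phi_Qn_tendsto_zero (n : ℕ) (hn : 1 ≤ n) (J₀ J : ℝ) (hJ₀ : 0 < J₀)
    (h₁ : J ≠ J₀) (h₂ : J ≠ -J₀) :
    (∃ β₀ > (0:ℝ), ∀ β > β₀, 0 < Δ J₀ J β) ∧
    Filter.Tendsto
      (fun β : ℝ =>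
        (1 / (2 * ξ₀ J₀ J β)) * (ξ₀ J₀ J β - ξ₃ J₀ J β) ^ (2 ^ n)
          * ((C₁ J₀ J β + C₂ J₀ J β + C₃ J₀ J β) / 4) ^ (2 ^ n - 1))
      Filter.atTop (nhds 0) := by
  have hJ : |J| ≠ J₀ := fun h => (eq_or_eq_neg_of_abs_eq h).elim h₁ h₂
  have hΔ := tendsto_Δ hJ₀ hJ
  have hC₃ := tendsto_C₃_atTop hJ₀ J
  constructor
  · obtain ⟨b, hb⟩ := eventually_atTop.mp (hΔ.eventually (lt_mem_nhds one_pos))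
    exact ⟨max b 1, by positivity, fun β hβ => hb β ((le_max_left b 1).trans hβ.le)⟩
  · have hsqrt : Tendsto (fun β => 1 - √(Δ J₀ J β)) atTop (𝓝 0) := by
      simpa using hΔ.sqrt.const_sub 1
    have hratio : Tendsto (fun β => 1 / 2 + 1 / 4 * (C₃ J₀ J β)⁻¹) atTop (𝓝 (1 / 2)) := by
      simpa only [mul_zero, add_zero, Function.comp_apply] using
        ((tendsto_inv_atTop_zero.comp hC₃).const_mul (1 / 4)).const_add (1 / 2)
    have hlim := ((hsqrt.pow (2 ^ n)).const_mul (1 / 2)).mul (hratio.pow (2 ^ n - 1))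
    rw [zero_pow (by positivity), mul_zero, zero_mul] at hlim
    refine hlim.congr' ?_
    filter_upwards [hC₃.eventually_gt_atTop 0] with β hβ
    have hdiff : ξ₀ J₀ J β - ξ₃ J₀ J β = (1 - √(Δ J₀ J β)) / C₃ J₀ J β := by
      rw [ξ₀, ξ₃, sub_div]
    have hquot : 1 / 2 + 1 / 4 * (C₃ J₀ J β)⁻¹ = (2 * C₃ J₀ J β + 1) / 4 / C₃ J₀ J β := by
      field_simp
      ring
    obtain ⟨k, hk⟩ : ∃ k, 2 ^ n = k + 1 := Nat.exists_eq_succ_of_ne_zero (by positivity)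
    rw [C₁_add_C₂_add_C₃, hdiff, hquot, ξ₀, hk, Nat.add_sub_cancel, div_pow, div_pow _ (C₃ J₀ J β)]
    field_simp
    ring
end
end

section
/- Let C₁, C₂, C₃, ξ₀, ξ₃ be real numbers with C₃ ≠ 0, ξ₀ = 1/C₃, C₂·ξ₃² = (C₃−C₁)·ξ₀², and 3C₃ − 2C₁ ≠ 0. Let N be the real 2×2 matrix [[C₁ξ₀, (1/2)C₃ξ₃], [C₂ξ₃, 1/2]] and set λ = C₁/C₃ − 1/2. Then for every natural number n, N^n applied to the vector (1/ξ₀, 0) equals (ρ̂₁ + ρ̂₂·λⁿ, ρ̌₁ + ρ̌₂·λⁿ), where ρ̂₁ = C₃²/(3C₃−2C₁), ρ̂₂ = 2C₃(C₃−C₁)/(3C₃−2C₁), ρ̌₁ = 2C₂C₃²ξ₃/(3C₃−2C₁), and ρ̌₂ = −2C₂C₃²ξ₃/(3C₃−2C₁). -/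
open Matrix

noncomputable section

/-- Powers of a matrix act on an eigenvector through powers of the eigenvalue. -/
theorem Matrix.pow_mulVec_of_mulVec_eq_smul {ι R : Type*} [Fintype ι] [DecidableEq ι]
    [CommSemiring R] {A : Matrix ι ι R} {v : ι → R} {μ : R} (h : A *ᵥ v = μ • v) (n : ℕ) :
    (A ^ n) *ᵥ v = μ ^ n • v := by
  induction n with
  | zero => simp
  | succ n ih => rw [pow_succ, ← mulVec_mulVec, h, mulVec_smul, ih, smul_smul, pow_succ']

theorem transfer_recurrence_closed_form
    (C₁ C₂ C₃ ξ₀ ξ₃ : ℝ) (hC₃ : C₃ ≠ 0) (hξ₀ : ξ₀ = 1 / C₃)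
    (hξ₃ : C₂ * ξ₃ ^ 2 = (C₃ - C₁) * ξ₀ ^ 2) (hden : 3 * C₃ - 2 * C₁ ≠ 0) :
    let N : Matrix (Fin 2) (Fin 2) ℝ := !![C₁ * ξ₀, (1/2) * C₃ * ξ₃; C₂ * ξ₃, 1/2]
    let lam : ℝ := C₁ / C₃ - 1/2
    let rho₁ : ℝ := C₃ ^ 2 / (3 * C₃ - 2 * C₁)          -- ρ̂₁
    let rho₂ : ℝ := 2 * C₃ * (C₃ - C₁) / (3 * C₃ - 2 * C₁)  -- ρ̂₂
    let rho₁' : ℝ := 2 * C₂ * C₃ ^ 2 * ξ₃ / (3 * C₃ - 2 * C₁)  -- ρ̌₁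
    let rho₂' : ℝ := -(2 * C₂ * C₃ ^ 2 * ξ₃) / (3 * C₃ - 2 * C₁)  -- ρ̌₂
    ∀ n : ℕ, (N ^ n).mulVec ![1 / ξ₀, 0]
      = ![rho₁ + rho₂ * lam ^ n, rho₁' + rho₂' * lam ^ n] := by
  intro N lam rho₁ rho₂ rho₁' rho₂' n
  subst hξ₀
  have hden_comm : C₃ * 3 - C₁ * 2 ≠ 0 := by convert hden using 1; ring
  have hsq : C₂ * ξ₃ ^ 2 * C₃ ^ 2 = C₃ - C₁ := by
    rw [hξ₃]
    field_simp
  have h₁ : N *ᵥ ![rho₁, rho₁'] = (1 : ℝ) • ![rho₁, rho₁'] := by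
    ext i
    fin_cases i
    · simp [N, rho₁, rho₁', mulVec, dotProduct, Fin.sum_univ_two]
      field_simp
      linear_combination hsq
    · simp [N, rho₁, rho₁', mulVec, dotProduct, Fin.sum_univ_two]
      field_simp
      ring
  have h₂ : N *ᵥ ![rho₂, rho₂'] = lam • ![rho₂, rho₂'] := by
    ext i
    fin_cases i
    · simp [N, lam, rho₂, rho₂', mulVec, dotProduct, Fin.sum_univ_two]
      field_simp
      linear_combination (-C₃) * hsq
    · simp [N, lam, rho₂, rho₂', mulVec, dotProduct, Fin.sum_univ_two]
      field_simp
      ring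
  have h₀ : ![1 / (1 / C₃), 0] = ![rho₁, rho₁'] + ![rho₂, rho₂'] := by
    ext i
    fin_cases i
    · simp only [rho₁, rho₂, one_div, inv_inv]
      simp [← add_div, eq_div_iff hden]
      ring
    · simp [rho₁', rho₂']
      ring
  rw [h₀, mulVec_add, pow_mulVec_of_mulVec_eq_smul h₁, pow_mulVec_of_mulVec_eq_smul h₂]
  ext i
  fin_cases i <;> simp [mul_comm]
end
end

section
/- Let C₁, C₂, C₃, ξ₀, ξ₃ be real numbers with C₃ ≠ 0, C₂ ≠ 0, ξ₀ = 1/C₃, C₂·ξ₃² = (C₃−C₁)·ξ₀², and 3C₃ − 2C₁ ≠ 0. Let N = [[C₁ξ₀, (1/2)C₃ξ₃], [C₂ξ₃, 1/2]] and P = [[C₃/(2C₂), −ξ₃/ξ₀], [ξ₃/ξ₀, 1]] as real 2×2 matrices. Then det(P) = (3C₃−2C₁)/(2C₂) ≠ 0, P is invertible, and N = P · diag(1, C₁/C₃ − 1/2) · P⁻¹. -/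
open Matrix

noncomputable section

theorem transfer_matrix_diagonalization
    (C₁ C₂ C₃ ξ₀ ξ₃ : ℝ) (hC₃ : C₃ ≠ 0) (hC₂ : C₂ ≠ 0) (hξ₀ : ξ₀ = 1 / C₃)
    (hξ₃ : C₂ * ξ₃ ^ 2 = (C₃ - C₁) * ξ₀ ^ 2) (hden : 3 * C₃ - 2 * C₁ ≠ 0) :
    let N : Matrix (Fin 2) (Fin 2) ℝ := !![C₁ * ξ₀, (1/2) * C₃ * ξ₃; C₂ * ξ₃, 1/2]
    let P : Matrix (Fin 2) (Fin 2) ℝ := !![C₃ / (2 * C₂), -(ξ₃ / ξ₀); ξ₃ / ξ₀, 1]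
    P.det = (3 * C₃ - 2 * C₁) / (2 * C₂) ∧ P.det ≠ 0 ∧ IsUnit P ∧
      N = P * Matrix.diagonal ![1, C₁ / C₃ - 1/2] * P⁻¹ := by
  intro N P
  subst hξ₀
  have hsq : C₂ * ξ₃ ^ 2 * C₃ ^ 2 = C₃ - C₁ := by
    rw [hξ₃]
    field_simp
  have hdet : P.det = (3 * C₃ - 2 * C₁) / (2 * C₂) := by
    simp only [P, det_fin_two_of]
    field_simp
    linear_combination 2 * hsq
  have hdet_ne : P.det ≠ 0 := by
    rw [hdet]
    exact div_ne_zero hden (mul_ne_zero two_ne_zero hC₂)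
  have hNP : N * P = P * Matrix.diagonal ![1, C₁ / C₃ - 1/2] := by
    ext i j
    fin_cases i <;> fin_cases j <;> simp [N, P, Matrix.mul_apply, Fin.sum_univ_two] <;> field_simp
    · linear_combination hsq
    · ring
    · ring
    · linear_combination -2 * hsq
  refine ⟨hdet, hdet_ne, (isUnit_iff_isUnit_det P).2 hdet_ne.isUnit, ?_⟩
  rw [← hNP, mul_nonsing_inv_cancel_right _ _ hdet_ne.isUnit]
end
end

section
/- Let c₁, c₂, c₃, ξ₀, ξ₃ be real numbers with c₃·ξ₀ = 1, c₂·ξ₃² = (c₃−c₁)·ξ₀², c₂·ξ₃ ≠ 0, and 3 − 2c₁ξ₀ ≠ 0. Let A = [[c₁ξ₀, −c₂ξ₃], [−(c₃/2)ξ₃, (c₃/2)ξ₀]], μ = c₁ξ₀ − 1/2, and set η₁ = 1/(3−2c₁ξ₀), η̂₁ = 2(1−c₁ξ₀)/(3−2c₁ξ₀), η₂ = −2c₂ξ₃/(3−2c₁ξ₀), η̂₂ = (c₁ξ₀−1)/(c₂ξ₃(3−2c₁ξ₀)). Then for every natural number m, A^m = [[η₁ + η̂₁·μ^m, η₂ −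 η₂·μ^m], [η̂₂ − η̂₂·μ^m, η̂₁ + η₁·μ^m]]. -/
open Matrix

noncomputable section

/-- Powers of a `2 × 2` matrix with eigenvalues `1` and `a - 1/2`. -/
theorem pow_eq_of_eigenvalue_one {K : Type*} [Field K] [NeZero (2 : K)] (a b : K) (hb : b ≠ 0)
    (ha : 3 - 2 * a ≠ 0) (m : ℕ) :
    (!![a, -b; -((1 - a) / (2 * b)), 1 / 2] : Matrix (Fin 2) (Fin 2) K) ^ m =
      !![1 / (3 - 2 * a) + 2 * (1 - a) / (3 - 2 * a) * (a - 1 / 2) ^ m,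
         -(2 * b) / (3 - 2 * a) - -(2 * b) / (3 - 2 * a) * (a - 1 / 2) ^ m;
         (a - 1) / (b * (3 - 2 * a)) - (a - 1) / (b * (3 - 2 * a)) * (a - 1 / 2) ^ m,
         2 * (1 - a) / (3 - 2 * a) + 1 / (3 - 2 * a) * (a - 1 / 2) ^ m] := by
  have h2 : (2 : K) ≠ 0 := two_ne_zero
  induction m with
  | zero =>
    ext i j
    fin_cases i <;> fin_cases j <;> simp <;> field_simp <;> ring
  | succ k ih =>
    rw [pow_succ, ih, pow_succ]
    generalize (a - 1 / 2) ^ k = x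
    ext i j
    fin_cases i <;> fin_cases j <;> simp [Matrix.mul_apply, Fin.sum_univ_two] <;>
      field_simp <;> ring

theorem clustering_matrix_pow
    (c₁ c₂ c₃ ξ₀ ξ₃ : ℝ) (hξ₀ : c₃ * ξ₀ = 1)
    (hξ₃ : c₂ * ξ₃ ^ 2 = (c₃ - c₁) * ξ₀ ^ 2) (hc₂ξ₃ : c₂ * ξ₃ ≠ 0)
    (hden : 3 - 2 * c₁ * ξ₀ ≠ 0) :
    let A : Matrix (Fin 2) (Fin 2) ℝ :=
      !![c₁ * ξ₀, -(c₂ * ξ₃); -(c₃ / 2) * ξ₃, (c₃ / 2) * ξ₀]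
    let μ : ℝ := c₁ * ξ₀ - 1/2
    let η₁ : ℝ := 1 / (3 - 2 * c₁ * ξ₀)
    let η₁' : ℝ := 2 * (1 - c₁ * ξ₀) / (3 - 2 * c₁ * ξ₀)   -- η̂₁
    let η₂ : ℝ := -(2 * c₂ * ξ₃) / (3 - 2 * c₁ * ξ₀)
    let η₂' : ℝ := (c₁ * ξ₀ - 1) / (c₂ * ξ₃ * (3 - 2 * c₁ * ξ₀))  -- η̂₂
    ∀ m : ℕ, A ^ m
      = !![η₁ + η₁' * μ ^ m, η₂ - η₂ * μ ^ m;
           η₂' - η₂' * μ ^ m, η₁' + η₁ * μ ^ m] := by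
  intro A μ η₁ η₁' η₂ η₂' m
  have hA : A = !![c₁ * ξ₀, -(c₂ * ξ₃); -((1 - c₁ * ξ₀) / (2 * (c₂ * ξ₃))), 1 / 2] := by
    have h₁ : -(c₃ / 2) * ξ₃ = -((1 - c₁ * ξ₀) / (2 * (c₂ * ξ₃))) := by
      rw [neg_mul, neg_inj, eq_div_iff (mul_ne_zero two_ne_zero hc₂ξ₃)]
      linear_combination c₃ * hξ₃ + (c₃ * ξ₀ + 1 - c₁ * ξ₀) * hξ₀
    have h₂ : c₃ / 2 * ξ₀ = 1 / 2 := by linear_combination hξ₀ / 2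
    simp only [A, h₁, h₂]
  rw [hA, pow_eq_of_eigenvalue_one _ _ hc₂ξ₃ (by rwa [← mul_assoc])]
  simp only [μ, η₁, η₁', η₂, η₂', mul_assoc]
end
end
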